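/- Proposition 2.3, second claim (linear quantitative form). Suppose J₀ ∈ 𝒥(V, ω) and J₁ ∈ 𝒥(V, ω) both satisfy the taming bounds (1.1) with constants (α₀, β₀) with respect to μ. Then J₁ + J₀ is invertible, and setting W := −(J₁ − J₀)(J₁ + J₀)^{−1}, for every t ∈ [0, 1] the endomorphism J_t := J₀(id − tW)^{−1}(id + tW) is an ω-compatible linear complex structure on V; the map t ↦ J_t is infinitely differentiable as a map from [0, 1] into the endomorphisms of V, equals J₀ at t = 0 and J₁ at t = 1, and satisfies ω(u, J_t u) = g_{J_t}(u, u) ≥ (α₀³/β₀²)‖u‖_μ² for all u ∈ V and all t ∈ [0, 1]. In particular, the set of those J ∈ 𝒥(V, ω) that satisfy the taming bounds (1.1) with respect to μ for some positive constants is path-connected. -/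

import Mathlib

/-- `J` is an `ω`-compatible linear complex structure. -/
def IsCompatibleComplexStructure {V : Type*} [NormedAddCommGroup V] [NormedSpace ℝ V]
    (ω : V →ₗ[ℝ] V →ₗ[ℝ] ℝ) (J : V →L[ℝ] V) : Prop :=
  J * J = -1 ∧ (∀ u v : V, ω (J u) (J v) = ω u v) ∧ ∀ u : V, u ≠ 0 → 0 < ω u (J u)

/-- The Cayley transform `-(J₁ - J₀)(J₁ + J₀)⁻¹`. -/
noncomputable def cayleyTransform {R : Type*} [Ring R] (J₀ J₁ : R) : R :=
  -(J₁ - J₀) * Ring.inverse (J₁ + J₀)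

/-- The curve `J (1 - tW)⁻¹ (1 + tW)`. -/
noncomputable def cayleyCurve {R : Type*} [Ring R] [Module ℝ R] (J W : R) (t : ℝ) : R :=
  J * Ring.inverse (1 - t • W) * (1 + t • W)

section Ring

variable {R : Type*} [Ring R] {J₀ J₁ : R}

lemma cayleyTransform_mul_add (h : IsUnit (J₁ + J₀)) :
    cayleyTransform J₀ J₁ * (J₁ + J₀) = -(J₁ - J₀) := by
  rw [cayleyTransform, mul_assoc, Ring.inverse_mul_cancel _ h, mul_one]

lemma cayleyTransform_mul_left (h₀ : J₀ * J₀ = -1) (h₁ : J₁ * J₁ = -1)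
    (h : IsUnit (J₁ + J₀)) :
    cayleyTransform J₀ J₁ * J₀ = -(J₀ * cayleyTransform J₀ J₁) := by
  have hW := cayleyTransform_mul_add h
  refine h.mul_right_cancel ?_
  calc cayleyTransform J₀ J₁ * J₀ * (J₁ + J₀)
      = cayleyTransform J₀ J₁ * (J₁ + J₀) * J₁ := by
        simp only [mul_assoc, mul_add, add_mul, h₀, h₁]; abel
    _ = J₀ * (J₁ - J₀) := by
        rw [hW]; simp only [neg_mul, sub_mul, mul_sub, h₀, h₁]; abel
    _ = -(J₀ * cayleyTransform J₀ J₁) * (J₁ + J₀) := by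
        rw [neg_mul, mul_assoc, hW, mul_neg, neg_neg]

variable [Module ℝ R]

lemma cayleyCurve_zero (J W : R) : cayleyCurve J W 0 = J := by
  simp [cayleyCurve]

lemma cayleyCurve_one (h₀ : J₀ * J₀ = -1) (h₁ : J₁ * J₁ = -1) (h : IsUnit (J₁ + J₀))
    (hu : IsUnit (1 - cayleyTransform J₀ J₁)) :
    cayleyCurve J₀ (cayleyTransform J₀ J₁) 1 = J₁ := by
  have hW := cayleyTransform_mul_add h
  set W := cayleyTransform J₀ J₁
  have key : (1 - W) * (-(J₀ * J₁)) = 1 + W := by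
    refine h.mul_right_cancel ?_
    have e : (-(J₀ * J₁)) * (J₁ + J₀) = (J₁ + J₀) * (-(J₁ * J₀)) := by
      have a : J₀ * J₁ * J₁ = -J₀ := by rw [mul_assoc, h₁, mul_neg_one]
      have b : J₁ * (J₁ * J₀) = -J₀ := by rw [← mul_assoc, h₁, neg_one_mul]
      simp only [neg_mul, mul_neg, mul_add, add_mul, a, b, mul_assoc J₀ J₁ J₀]
      abel
    have c : J₁ * (J₁ * J₀) = -J₀ := by rw [← mul_assoc, h₁, neg_one_mul]
    rw [mul_assoc, e, ← mul_assoc, sub_mul, add_mul, hW]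
    simp only [one_mul, mul_neg, add_mul, sub_mul, neg_mul, c]
    abel
  rw [cayleyCurve, one_smul, ← key, mul_assoc, ← mul_assoc (Ring.inverse _),
    Ring.inverse_mul_cancel _ hu, one_mul, mul_neg, ← mul_assoc, h₀]
  simp

end Ring

section Compatible

variable {V : Type*} [NormedAddCommGroup V] [NormedSpace ℝ V]
  {ω : V →ₗ[ℝ] V →ₗ[ℝ] ℝ} {J J₀ J₁ W : V →L[ℝ] V}

lemma LinearMap.skew_of_apply_self_eq_zero (hω : ∀ u, ω u u = 0) (u v : V) :
    ω u v = -ω v u := by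
  have := hω (u + v)
  simp only [map_add, LinearMap.add_apply, hω] at this
  linarith

namespace IsCompatibleComplexStructure

lemma apply_apply (h : IsCompatibleComplexStructure ω J) (u : V) : J (J u) = -u := by
  simpa using DFunLike.congr_fun h.1 u

lemma apply_left (h : IsCompatibleComplexStructure ω J) (u v : V) :
    ω (J u) v = -ω u (J v) := by
  rw [← h.2.1 (J u) v, h.apply_apply]; simp

lemma symm (hω : ∀ u, ω u u = 0) (h : IsCompatibleComplexStructure ω J) (u v : V) :
    ω u (J v) = ω v (J u) := by
  rw [LinearMap.skew_of_apply_self_eq_zero hω, h.apply_left, neg_neg]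

lemma nonneg (h : IsCompatibleComplexStructure ω J) (u : V) : 0 ≤ ω u (J u) := by
  rcases eq_or_ne u 0 with rfl | hu
  · simp
  · exact (h.2.2 u hu).le

/-- The hypotheses on `W` ensuring that `cayleyCurve J W t` is a compatible complex structure for
`t ∈ [0, 1]`: `W` anticommutes with `J`, is skew for `ω`, and is a strict contraction for `g_J`. -/
structure IsCayleyDirection (ω : V →ₗ[ℝ] V →ₗ[ℝ] ℝ) (J W : V →L[ℝ] V) : Prop where
  anticomm : W * J = -(J * W)
  skew : ∀ u v, ω (W u) v = -ω u (W v)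
  contraction : ∀ u, u ≠ 0 → ω (W u) (J (W u)) < ω u (J u)

lemma sq_mul_lt (h : IsCompatibleComplexStructure ω J) (hW : IsCayleyDirection ω J W) {t : ℝ}
    (ht : t ∈ Set.Icc (0 : ℝ) 1) (u : V) (hu : u ≠ 0) :
    t ^ 2 * ω (W u) (J (W u)) < ω u (J u) := by
  refine lt_of_le_of_lt ?_ (hW.contraction u hu)
  exact mul_le_of_le_one_left (h.nonneg _) (pow_le_one₀ ht.1 ht.2)

lemma cayleyCurve_apply_sub {t : ℝ} (hu : IsUnit (1 - t • W)) (x : V) :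
    cayleyCurve J W t (x - t • W x) = J (x + t • W x) := by
  have hc : (1 + t • W) * (1 - t • W) = (1 - t • W) * (1 + t • W) := by
    simp only [add_mul, mul_sub, sub_mul, mul_add, one_mul, mul_one]
    abel
  have e : cayleyCurve J W t * (1 - t • W) = J * (1 + t • W) := by
    rw [cayleyCurve, mul_assoc, hc, mul_assoc, ← mul_assoc (Ring.inverse _),
      Ring.inverse_mul_cancel _ hu, one_mul]
  simpa using DFunLike.congr_fun e x

lemma exists_eq_sub_smul {t : ℝ} (hu : IsUnit (1 - t • W)) (u : V) : ∃ x, u = x - t • W x :=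
  ⟨Ring.inverse (1 - t • W) u, by
    simpa using (DFunLike.congr_fun (Ring.mul_inverse_cancel _ hu) u).symm⟩

lemma apply_cayleyCurve (hω : ∀ u, ω u u = 0) (h : IsCompatibleComplexStructure ω J)
    {t : ℝ} (hu : IsUnit (1 - t • W)) (x : V) :
    ω (x - t • W x) (cayleyCurve J W t (x - t • W x)) =
      ω x (J x) - t ^ 2 * ω (W x) (J (W x)) := by
  have e := h.symm hω x (W x)
  rw [cayleyCurve_apply_sub hu]
  simp only [map_add, map_sub, map_smul, LinearMap.sub_apply, LinearMap.smul_apply, smul_eq_mul]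
  rw [e]
  ring

lemma apply_le_of_tame {μ : V →ₗ[ℝ] V →ₗ[ℝ] ℝ} (hμ : ∀ u, 0 ≤ μ u u)
    (h : IsCompatibleComplexStructure ω J) {α β : ℝ} (hα : 0 < α)
    (htame : ∀ u, α * μ u u ≤ ω u (J u))
    (hbound : ∀ u v, |ω u v| ≤ β * Real.sqrt (μ u u) * Real.sqrt (μ v v)) (u : V) :
    α * ω u (J u) ≤ β ^ 2 * μ u u := by
  have hg := h.nonneg u
  have h1 : α * μ (J u) (J u) ≤ ω u (J u) := by simpa [h.2.1] using htame (J u)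
  have h2 : ω u (J u) ^ 2 ≤ β ^ 2 * μ u u * μ (J u) (J u) := by
    calc ω u (J u) ^ 2 ≤ (β * Real.sqrt (μ u u) * Real.sqrt (μ (J u) (J u))) ^ 2 :=
          pow_le_pow_left₀ hg ((le_abs_self _).trans (hbound u (J u))) 2
      _ = β ^ 2 * μ u u * μ (J u) (J u) := by
          rw [mul_pow, mul_pow, Real.sq_sqrt (hμ _), Real.sq_sqrt (hμ _)]
  have h3 : 0 ≤ β ^ 2 * μ u u := mul_nonneg (sq_nonneg β) (hμ u)
  rcases hg.eq_or_lt with h0 | h0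
  · rwa [← h0, mul_zero]
  · refine le_of_mul_le_mul_right ?_ h0
    nlinarith [mul_le_mul_of_nonneg_left h1 h3, mul_le_mul_of_nonneg_left h2 hα.le]

end IsCompatibleComplexStructure

variable [FiniteDimensional ℝ V]

lemma ContinuousLinearMap.isUnit_of_forall_eq_zero (T : V →L[ℝ] V)
    (h : ∀ x, T x = 0 → x = 0) : IsUnit T := by
  have := FiniteDimensional.complete ℝ V
  have hi : Function.Injective T := (injective_iff_map_eq_zero T).2 h
  exact ContinuousLinearMap.isUnit_iff_bijective.2
    ⟨hi, (LinearMap.injective_iff_surjective (f := (T : V →ₗ[ℝ] V))).1 hi⟩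

namespace IsCompatibleComplexStructure

lemma isUnit_add (h₀ : IsCompatibleComplexStructure ω J₀)
    (h₁ : IsCompatibleComplexStructure ω J₁) : IsUnit (J₁ + J₀) := by
  refine ContinuousLinearMap.isUnit_of_forall_eq_zero _ fun x hx => ?_
  by_contra hne
  have h := congrArg (ω x) hx
  simp only [add_apply, map_add, map_zero] at h
  linarith [h₀.2.2 x hne, h₁.2.2 x hne]

lemma exists_add_apply_eq (h₀ : IsCompatibleComplexStructure ω J₀)
    (h₁ : IsCompatibleComplexStructure ω J₁) (u : V) :
    ∃ x, u = J₁ x + J₀ x ∧ cayleyTransform J₀ J₁ u = -(J₁ x - J₀ x) := by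
  have hu := isUnit_add h₀ h₁
  have h := DFunLike.congr_fun (Ring.mul_inverse_cancel _ hu) u
  refine ⟨Ring.inverse (J₁ + J₀) u, ?_, ?_⟩
  · simpa using h.symm
  · simp [cayleyTransform]

lemma cayleyTransform_apply_left (h₀ : IsCompatibleComplexStructure ω J₀)
    (h₁ : IsCompatibleComplexStructure ω J₁) (u v : V) :
    ω (cayleyTransform J₀ J₁ u) v = -ω u (cayleyTransform J₀ J₁ v) := by
  obtain ⟨x, hx, hWx⟩ := exists_add_apply_eq h₀ h₁ u
  obtain ⟨y, hy, hWy⟩ := exists_add_apply_eq h₀ h₁ v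
  rw [hWx, hWy, hx, hy]
  simp only [map_add, map_sub, map_neg, LinearMap.add_apply, LinearMap.sub_apply,
    LinearMap.neg_apply, h₀.2.1, h₁.2.1]
  ring

lemma cayleyTransform_contraction (hω : ∀ u, ω u u = 0)
    (h₀ : IsCompatibleComplexStructure ω J₀) (h₁ : IsCompatibleComplexStructure ω J₁)
    (u : V) (hu : u ≠ 0) :
    ω (cayleyTransform J₀ J₁ u) (J₀ (cayleyTransform J₀ J₁ u)) < ω u (J₀ u) := by
  obtain ⟨x, hx, hWx⟩ := exists_add_apply_eq h₀ h₁ u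
  have hx0 : x ≠ 0 := by rintro rfl; exact hu (by simpa using hx)
  have hpos := h₁.2.2 x hx0
  have e := h₀.symm hω (J₁ x) (J₀ x)
  have e' : ω (J₁ x) (J₀ (J₀ x)) = ω x (J₁ x) := by
    rw [h₀.apply_apply, map_neg, h₁.apply_left, neg_neg]
  rw [hWx, hx]
  simp only [map_add, map_sub, map_neg, LinearMap.add_apply, LinearMap.sub_apply,
    LinearMap.neg_apply]
  linarith

lemma isCayleyDirection_cayleyTransform (hω : ∀ u, ω u u = 0)
    (h₀ : IsCompatibleComplexStructure ω J₀) (h₁ : IsCompatibleComplexStructure ω J₁) :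
    IsCayleyDirection ω J₀ (cayleyTransform J₀ J₁) :=
  ⟨cayleyTransform_mul_left h₀.1 h₁.1 (isUnit_add h₀ h₁), cayleyTransform_apply_left h₀ h₁,
    cayleyTransform_contraction hω h₀ h₁⟩

lemma isUnit_one_sub_smul (h : IsCompatibleComplexStructure ω J) (hW : IsCayleyDirection ω J W)
    {t : ℝ} (ht : t ∈ Set.Icc (0 : ℝ) 1) : IsUnit (1 - t • W) := by
  refine ContinuousLinearMap.isUnit_of_forall_eq_zero _ fun x hx => ?_
  by_contra hne
  have hx' : x = t • W x := by simpa [sub_eq_zero] using hx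
  have hlt := sq_mul_lt h hW ht x hne
  have e : ω x (J x) = t ^ 2 * ω (W x) (J (W x)) := by
    conv_lhs => rw [hx']
    simp only [map_smul, LinearMap.smul_apply, smul_eq_mul]
    ring
  linarith

lemma isCompatibleComplexStructure_cayleyCurve (hω : ∀ u, ω u u = 0) (h : IsCompatibleComplexStructure ω J)
    (hW : IsCayleyDirection ω J W) {t : ℝ} (ht : t ∈ Set.Icc (0 : ℝ) 1) :
    IsCompatibleComplexStructure ω (cayleyCurve J W t) := by
  have hu := isUnit_one_sub_smul h hW ht
  refine ⟨?_, fun u v => ?_, fun u hu0 => ?_⟩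
  · ext u
    obtain ⟨x, rfl⟩ := exists_eq_sub_smul hu u
    have hWJ : ∀ y, W (J y) = -J (W y) := fun y => by
      simpa using DFunLike.congr_fun hW.anticomm y
    have e : J (x + t • W x) = J x - t • W (J x) := by simp [hWJ]
    rw [mul_apply_eq_comp, cayleyCurve_apply_sub hu, e, cayleyCurve_apply_sub hu]
    simp [hWJ, h.apply_apply]
    abel
  · obtain ⟨x, rfl⟩ := exists_eq_sub_smul hu u
    obtain ⟨y, rfl⟩ := exists_eq_sub_smul hu v
    rw [cayleyCurve_apply_sub hu, cayleyCurve_apply_sub hu, h.2.1]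
    simp only [map_add, map_sub, map_smul, LinearMap.add_apply, LinearMap.sub_apply,
      LinearMap.smul_apply, smul_eq_mul, hW.skew]
    ring
  · obtain ⟨x, rfl⟩ := exists_eq_sub_smul hu u
    have hx0 : x ≠ 0 := by rintro rfl; exact hu0 (by simp)
    rw [apply_cayleyCurve hω h hu]
    linarith [sq_mul_lt h hW ht x hx0]

lemma contDiffOn_cayleyCurve (h : IsCompatibleComplexStructure ω J)
    (hW : IsCayleyDirection ω J W) :
    ContDiffOn ℝ (⊤ : ℕ∞) (fun t => cayleyCurve J W t) (Set.Icc (0 : ℝ) 1) := by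
  have := FiniteDimensional.complete ℝ V
  intro t ht
  obtain ⟨a, ha⟩ := isUnit_one_sub_smul h hW ht
  have hinv : ContDiffAt ℝ (⊤ : ℕ∞) (Ring.inverse : (V →L[ℝ] V) → _) (1 - t • W) :=
    ha ▸ contDiffAt_ringInverse ℝ a
  have hA : ContDiffAt ℝ (⊤ : ℕ∞) (fun t : ℝ => 1 - t • W) t := by fun_prop
  have hB : ContDiffAt ℝ (⊤ : ℕ∞) (fun t : ℝ => 1 + t • W) t := by fun_prop
  exact ((contDiffAt_const.mul (hinv.comp t hA)).mul hB).contDiffWithinAt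

/-- Since `t ↦ g_t` pulled back along `1 - tW` is concave in `t`, a lower bound of `g_t` by a
multiple of `g_J` at the end points persists on `[0, 1]`. -/
lemma le_apply_cayleyCurve (hω : ∀ u, ω u u = 0) (h : IsCompatibleComplexStructure ω J)
    (hW : IsCayleyDirection ω J W) {c : ℝ} (hc : 0 ≤ c)
    (hzero : ∀ u, c * ω u (J u) ≤ ω u (J u))
    (hone : ∀ u, c * ω u (J u) ≤ ω u (cayleyCurve J W 1 u))
    {t : ℝ} (ht : t ∈ Set.Icc (0 : ℝ) 1) (u : V) :
    c * ω u (J u) ≤ ω u (cayleyCurve J W t u) := by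
  have hu := isUnit_one_sub_smul h hW ht
  obtain ⟨x, rfl⟩ := exists_eq_sub_smul hu u
  rw [apply_cayleyCurve hω h hu]
  have h1 := hone (x - (1 : ℝ) • W x)
  rw [apply_cayleyCurve hω h (isUnit_one_sub_smul h hW (by simp))] at h1
  have h0 := hzero x
  have hr := h.nonneg (W x)
  have e := h.symm hω x (W x)
  simp only [map_sub, map_smul, LinearMap.sub_apply, LinearMap.smul_apply, smul_eq_mul, e]
    at h1 ⊢
  have hconc : 0 ≤ (1 + c) * (t * (1 - t)) * ω (W x) (J (W x)) :=
    mul_nonneg (mul_nonneg (by linarith) (mul_nonneg ht.1 (by linarith [ht.2]))) hr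
  nlinarith [mul_le_mul_of_nonneg_left h1 ht.1,
    mul_le_mul_of_nonneg_left h0 (sub_nonneg.2 ht.2)]

lemma cayleyCurve_cayleyTransform_one (hω : ∀ u, ω u u = 0)
    (h₀ : IsCompatibleComplexStructure ω J₀) (h₁ : IsCompatibleComplexStructure ω J₁) :
    cayleyCurve J₀ (cayleyTransform J₀ J₁) 1 = J₁ := by
  refine cayleyCurve_one h₀.1 h₁.1 (isUnit_add h₀ h₁) ?_
  simpa using isUnit_one_sub_smul h₀ (isCayleyDirection_cayleyTransform hω h₀ h₁) (t := 1)
    (by simp)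

lemma cayleyCurve_tame (hω : ∀ u, ω u u = 0) {μ : V →ₗ[ℝ] V →ₗ[ℝ] ℝ} (hμ : ∀ u, 0 ≤ μ u u)
    (h₀ : IsCompatibleComplexStructure ω J₀) (h₁ : IsCompatibleComplexStructure ω J₁)
    {α β : ℝ} (hα : 0 < α) (hβ : 0 < β)
    (htame₀ : ∀ u, α * μ u u ≤ ω u (J₀ u)) (htame₁ : ∀ u, α * μ u u ≤ ω u (J₁ u))
    (hbound : ∀ u v, |ω u v| ≤ β * Real.sqrt (μ u u) * Real.sqrt (μ v v))
    {t : ℝ} (ht : t ∈ Set.Icc (0 : ℝ) 1) (u : V) :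
    α ^ 3 / β ^ 2 * μ u u ≤ ω u (cayleyCurve J₀ (cayleyTransform J₀ J₁) t u) := by
  have hW := isCayleyDirection_cayleyTransform hω h₀ h₁
  have hc : 0 ≤ α ^ 2 / β ^ 2 := by positivity
  have hle : ∀ v, α ^ 2 / β ^ 2 * ω v (J₀ v) ≤ α * μ v v := fun v => by
    rw [div_mul_eq_mul_div, div_le_iff₀ (by positivity)]
    nlinarith [mul_le_mul_of_nonneg_left (apply_le_of_tame hμ h₀ hα htame₀ hbound v) hα.le]
  have key := le_apply_cayleyCurve hω h₀ hW hc (fun v => (hle v).trans (htame₀ v))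
    (fun v => by
      rw [cayleyCurve_cayleyTransform_one hω h₀ h₁]
      exact (hle v).trans (htame₁ v)) ht u
  refine le_trans ?_ key
  calc α ^ 3 / β ^ 2 * μ u u = α ^ 2 / β ^ 2 * (α * μ u u) := by ring
    _ ≤ _ := mul_le_mul_of_nonneg_left (htame₀ u) hc

end IsCompatibleComplexStructure

end Compatible


/-- Proposition 2.3, second claim (linear quantitative form): if `J₀, J₁ ∈ 𝒥(V,ω)`
both satisfy the taming bounds (1.1) with constants `(α₀, β₀)` w.r.t. `μ`, then
`J₁ + J₀` is invertible; with `W := -(J₁ - J₀)(J₁ + J₀)⁻¹`, for every `t ∈ [0,1]`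
the endomorphism `J_t := J₀(id - tW)⁻¹(id + tW)` is an `ω`-compatible linear complex
structure, `t ↦ J_t` is smooth on `[0,1]`, equals `J₀` at `0` and `J₁` at `1`, and
`ω(u, J_t u) = g_{J_t}(u,u) ≥ (α₀³/β₀²)‖u‖_μ²` for all `u` and `t ∈ [0,1]`. In
particular the set of tamed compatible complex structures is path-connected. -/
theorem prop_2_3_second_claim_linear
    (V : Type*) [NormedAddCommGroup V] [NormedSpace ℝ V] [FiniteDimensional ℝ V]
    (ω : V →ₗ[ℝ] V →ₗ[ℝ] ℝ)
    (hω_alt : ∀ u : V, ω u u = 0)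
    (hω_nondeg : ∀ u : V, (∀ v : V, ω u v = 0) → u = 0)
    (μ : V →ₗ[ℝ] V →ₗ[ℝ] ℝ)
    (hμ_symm : ∀ u v : V, μ u v = μ v u)
    (hμ_pos : ∀ u : V, u ≠ 0 → 0 < μ u u)
    (α₀ β₀ : ℝ) (hα₀ : 0 < α₀) (hβ₀ : 0 < β₀)
    (J₀ J₁ : V →L[ℝ] V)
    (hJ₀_sq : J₀ * J₀ = -1)
    (hJ₀_compat : ∀ u v : V, ω (J₀ u) (J₀ v) = ω u v)
    (hJ₀_pos : ∀ u : V, u ≠ 0 → 0 < ω u (J₀ u))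
    (hJ₁_sq : J₁ * J₁ = -1)
    (hJ₁_compat : ∀ u v : V, ω (J₁ u) (J₁ v) = ω u v)
    (hJ₁_pos : ∀ u : V, u ≠ 0 → 0 < ω u (J₁ u))
    (hJ₀_tame₁ : ∀ X : V, α₀ * μ X X ≤ ω X (J₀ X))
    (hJ₁_tame₁ : ∀ X : V, α₀ * μ X X ≤ ω X (J₁ X))
    (h_tame₂ : ∀ X Y : V, |ω X Y| ≤ β₀ * Real.sqrt (μ X X) * Real.sqrt (μ Y Y)) :
    IsUnit (J₁ + J₀) ∧
    (∀ W : V →L[ℝ] V, W = -(J₁ - J₀) * Ring.inverse (J₁ + J₀) →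
      (∀ t ∈ Set.Icc (0 : ℝ) 1,
        ∀ Jt : V →L[ℝ] V, Jt = J₀ * Ring.inverse (1 - t • W) * (1 + t • W) →
          (Jt * Jt = -1) ∧
          (∀ u v : V, ω (Jt u) (Jt v) = ω u v) ∧
          (∀ u : V, u ≠ 0 → 0 < ω u (Jt u)) ∧
          (∀ u : V, ω u (Jt u) ≥ (α₀ ^ 3 / β₀ ^ 2) * μ u u)) ∧
      ContDiffOn ℝ (⊤ : ℕ∞)
        (fun t : ℝ => J₀ * Ring.inverse (1 - t • W) * (1 + t • W))
        (Set.Icc (0 : ℝ) 1) ∧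
      (J₀ * Ring.inverse (1 - (0 : ℝ) • W) * (1 + (0 : ℝ) • W) = J₀) ∧
      (J₀ * Ring.inverse (1 - (1 : ℝ) • W) * (1 + (1 : ℝ) • W) = J₁)) ∧
    IsPathConnected {J : V →L[ℝ] V |
      (J * J = -1 ∧ (∀ u v : V, ω (J u) (J v) = ω u v) ∧
        ∀ u : V, u ≠ 0 → 0 < ω u (J u)) ∧
      ∃ α β : ℝ, 0 < α ∧ 0 < β ∧
        (∀ X : V, α * μ X X ≤ ω X (J X)) ∧
        (∀ X Y : V, |ω X Y| ≤ β * Real.sqrt (μ X X) * Real.sqrt (μ Y Y))} := by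
  have hμ : ∀ u : V, 0 ≤ μ u u := fun u => by
    rcases eq_or_ne u 0 with rfl | hu
    · simp
    · exact (hμ_pos u hu).le
  have h₀ : IsCompatibleComplexStructure ω J₀ := ⟨hJ₀_sq, hJ₀_compat, hJ₀_pos⟩
  have h₁ : IsCompatibleComplexStructure ω J₁ := ⟨hJ₁_sq, hJ₁_compat, hJ₁_pos⟩
  refine ⟨h₀.isUnit_add h₁, ?_, J₀, ⟨h₀, α₀, β₀, hα₀, hβ₀, hJ₀_tame₁, h_tame₂⟩, ?_⟩
  · rintro W rfl
    have hW := IsCompatibleComplexStructure.isCayleyDirection_cayleyTransform hω_alt h₀ h₁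
    refine ⟨?_, h₀.contDiffOn_cayleyCurve hW, cayleyCurve_zero _ _,
      h₀.cayleyCurve_cayleyTransform_one hω_alt h₁⟩
    rintro t ht Jt rfl
    obtain ⟨hsq, hcompat, hpos⟩ :=
      h₀.isCompatibleComplexStructure_cayleyCurve hω_alt hW ht
    exact ⟨hsq, hcompat, hpos,
      h₀.cayleyCurve_tame hω_alt hμ h₁ hα₀ hβ₀ hJ₀_tame₁ hJ₁_tame₁ h_tame₂ ht⟩
  · rintro J ⟨hJ, α, -, hα, -, hJ_tame, -⟩
    have hJ : IsCompatibleComplexStructure ω J := hJ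
    have hW := IsCompatibleComplexStructure.isCayleyDirection_cayleyTransform hω_alt h₀ hJ
    have hmin : 0 < min α₀ α := lt_min hα₀ hα
    refine JoinedIn.ofLine (f := fun t => cayleyCurve J₀ (cayleyTransform J₀ J) t)
      (h₀.contDiffOn_cayleyCurve hW).continuousOn (cayleyCurve_zero _ _)
      (h₀.cayleyCurve_cayleyTransform_one hω_alt hJ) ?_
    rintro _ ⟨t, ht, rfl⟩
    exact ⟨h₀.isCompatibleComplexStructure_cayleyCurve hω_alt hW ht,
      min α₀ α ^ 3 / β₀ ^ 2, β₀, by positivity, hβ₀,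
      h₀.cayleyCurve_tame hω_alt hμ hJ hmin hβ₀
        (fun u => (mul_le_mul_of_nonneg_right (min_le_left _ _) (hμ u)).trans (hJ₀_tame₁ u))
        (fun u => (mul_le_mul_of_nonneg_right (min_le_right _ _) (hμ u)).trans (hJ_tame u))
        h_tame₂ ht, h_tame₂⟩
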